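/- Let K be a field of characteristic 0. (1) In K[G₂] set e = e_{U₀}, where U₀ is the subgroup of upper triangular matrices of G₂, and X = e·σ·e with σ the permutation matrix of (1,2). Then the K-linear operator ρ of right multiplication by X on the left module K[G₂]·e satisfies (ρ − 1)(ρ + q^{−1}) = 0, and both 1 and −q^{−1} occur as eigenvalues of ρ. (2) In K[G₃] set e' = e_{B₃}, where B₃ is the subgroup of upper triangular matrices of G₃, and X' = (−q)·e'·τ·e' with τ the permutation matrix of (1,3). Then the operator ρ' of right multiplication by X' on K[G₃]·e' satisfies (ρ' + q)(ρ' − q^{−2}) = 0, and both −q and q^{−2} occur as eigenvalues of ρ'. -/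

import Mathlib

open scoped MatrixGroups Matrix

noncomputable section

variable (F : Type*) [Field F]

/-- The anti-diagonal matrix `J` with entries 1 at positions `(i, n-1-i)`. -/
def Jmat (n : ℕ) : Matrix (Fin n) (Fin n) F :=
  Matrix.of fun i j => if j = Fin.rev i then 1 else 0

lemma Jmat_mul_self (n : ℕ) : Jmat F n * Jmat F n = 1 := by
  ext i j
  rw [Matrix.mul_apply]
  simp only [Jmat, Matrix.of_apply, Matrix.one_apply]
  rw [Finset.sum_eq_single (Fin.rev i)]
  · simp [Fin.rev_rev, eq_comm]
  · intro k _ hk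
    rw [if_neg hk, zero_mul]
  · exact fun h => absurd (Finset.mem_univ _) h

/-- `J` as an element of the general linear group. -/
def Junit (n : ℕ) : GL (Fin n) F :=
  ⟨Jmat F n, Jmat F n, Jmat_mul_self F n, Jmat_mul_self F n⟩

/-- The group automorphism `g ↦ ᵗg⁻¹` of `GL_n`. -/
def transposeInvHom (n : ℕ) : GL (Fin n) F →* GL (Fin n) F where
  toFun g := ⟨(g⁻¹).valᵀ, g.valᵀ,
    by rw [← Matrix.transpose_mul, ← Units.val_mul, mul_inv_cancel, Units.val_one,
      Matrix.transpose_one],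
    by rw [← Matrix.transpose_mul, ← Units.val_mul, inv_mul_cancel, Units.val_one,
      Matrix.transpose_one]⟩
  map_one' := by
    apply Units.ext
    show ((1 : GL (Fin n) F)⁻¹).valᵀ = _
    simp
  map_mul' g h := by
    apply Units.ext
    show ((g * h)⁻¹).valᵀ = (g⁻¹).valᵀ * (h⁻¹).valᵀ
    rw [mul_inv_rev, Units.val_mul, Matrix.transpose_mul]

/-- The twisted Frobenius endomorphism `g ↦ J · ᵗ(φ(g))⁻¹ · J` of `GL_n(F)`,
where `φ` is the `q`-power Frobenius. -/
def twistedFrobenius (φ : F →+* F) (n : ℕ) : GL (Fin n) F →* GL (Fin n) F :=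
  (MulAut.conj (Junit F n)).toMonoidHom.comp
    ((transposeInvHom F n).comp (Matrix.GeneralLinearGroup.map φ))

/-- The finite unitary group `GU_n(q)`, as the subgroup of `GL_n(𝔽_{q²})` of fixed
points of the twisted Frobenius, i.e. `g = J · ᵗ(g^{(q)})⁻¹ · J`. -/
def GU (φ : F →+* F) (n : ℕ) : Subgroup (GL (Fin n) F) where
  carrier := {g | twistedFrobenius F φ n g = g}
  one_mem' := by simp
  mul_mem' := by
    intro a b ha hb
    simp only [Set.mem_setOf_eq] at *
    rw [map_mul, ha, hb]
  inv_mem' := by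
    intro a ha
    simp only [Set.mem_setOf_eq] at *
    rw [map_inv, ha]

/-- The permutation matrix of a permutation `w`. -/
def permMat (n : ℕ) (w : Equiv.Perm (Fin n)) : Matrix (Fin n) (Fin n) F :=
  Matrix.of fun i j => if w i = j then 1 else 0

/-- The set of matrices underlying the subgroup `U_r ≤ G_{r+2}`: upper triangular
matrices whose middle `r × r` block is the identity. -/
def UrSet (r : ℕ) : Set (Matrix (Fin (r + 2)) (Fin (r + 2)) F) :=
  {g | (∀ i j : Fin (r + 2), (j : ℕ) < (i : ℕ) → g i j = 0) ∧
       (∀ i : Fin (r + 2), 1 ≤ (i : ℕ) → (i : ℕ) ≤ r → g i i = 1) ∧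
       (∀ i j : Fin (r + 2), 1 ≤ (i : ℕ) → (i : ℕ) < (j : ℕ) → (j : ℕ) ≤ r → g i j = 0)}

/-- Entries of the `o`-fold middle-block (centered) embedding of a matrix. -/
def cembFun {a : ℕ} (o : ℕ) (u : Matrix (Fin a) (Fin a) F) (p q : ℕ) : F :=
  if h : o ≤ p ∧ p < o + a ∧ o ≤ q ∧ q < o + a then
    u ⟨p - o, by omega⟩ ⟨q - o, by omega⟩
  else if p = q then 1 else 0

/-- The subgroup `U_{n,r} ≤ G_n` (for `n = r + 2m`), generated by `U_{n-2}` together with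
the images of `U_{n-4}, …, U_r` under the iterated middle-block embeddings. -/
def Unr (φ : F →+* F) (r m : ℕ) : Subgroup (GU F φ (r + 2 * m)) :=
  Subgroup.closure
    {g | ∃ k : ℕ, k < m ∧
      ∃ u : Matrix (Fin (r + 2 * k + 2)) (Fin (r + 2 * k + 2)) F,
        u ∈ UrSet F (r + 2 * k) ∧
        ∀ p q : Fin (r + 2 * m),
          ((g : GL (Fin (r + 2 * m)) F) : Matrix (Fin (r + 2 * m)) (Fin (r + 2 * m)) F) p q
            = cembFun F (m - 1 - k) u (p : ℕ) (q : ℕ)}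

/-- The idempotent `e_S = |S|⁻¹ ∑_{g ∈ S} g` in the group algebra `R[G]`. -/
def eSub (R : Type*) [CommRing R] {G : Type*} [Group G] (S : Subgroup G) :
    MonoidAlgebra R G :=
  Ring.inverse ((Nat.card S : R)) • ∑ᶠ g : S, MonoidAlgebra.of R G (g : G)

end
noncomputable section

variable (F : Type*) [Field F]

/-- The subgroup of upper triangular matrices in the unitary group `G_n`. -/
def borelGU (φ : F →+* F) (n : ℕ) : Subgroup (GU F φ n) where
  carrier := {g | Matrix.BlockTriangular
    ((g : GL (Fin n) F) : Matrix (Fin n) (Fin n) F) id}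
  one_mem' := by
    show Matrix.BlockTriangular _ id
    simp only [OneMemClass.coe_one, Units.val_one]
    exact Matrix.blockTriangular_one
  mul_mem' := by
    intro a b ha hb
    show Matrix.BlockTriangular _ id
    simp only [MulMemClass.coe_mul, Units.val_mul]
    exact Matrix.BlockTriangular.mul ha hb
  inv_mem' := by
    intro g hg
    show Matrix.BlockTriangular _ id
    have h1 : ((g⁻¹ : GU F φ n) : GL (Fin n) F) = ((g : GL (Fin n) F))⁻¹ := rfl
    rw [h1, Matrix.coe_units_inv]
    haveI := ((g : GL (Fin n) F)).invertible
    exact Matrix.blockTriangular_inv_of_blockTriangular hg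

end
section GroupAlgebra

variable {K : Type*} [Field K] {G : Type*} [Group G]

lemma eSub_eq_sum [Fintype G] (S : Subgroup G) [DecidablePred (· ∈ S)] :
    eSub K S = (Nat.card S : K)⁻¹ • ∑ g : S, MonoidAlgebra.of K G (g : G) := by
  rw [eSub, Ring.inverse_eq_inv', finsum_eq_sum_of_fintype]

variable [Finite G]

lemma eSub_mul_of {S : Subgroup G} {g : G} (hg : g ∈ S) :
    eSub K S * MonoidAlgebra.of K G g = eSub K S := by
  classical
  have := Fintype.ofFinite G
  rw [eSub_eq_sum, smul_mul_assoc, Finset.sum_mul]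
  congr 1
  exact Fintype.sum_equiv (Equiv.mulRight (⟨g, hg⟩ : S)) _ _ fun x => by simp

lemma of_mul_eSub {S : Subgroup G} {g : G} (hg : g ∈ S) :
    MonoidAlgebra.of K G g * eSub K S = eSub K S := by
  classical
  have := Fintype.ofFinite G
  rw [eSub_eq_sum, mul_smul_comm, Finset.mul_sum]
  congr 1
  exact Fintype.sum_equiv (Equiv.mulLeft (⟨g, hg⟩ : S)) _ _ fun x => by simp

variable [CharZero K]

lemma sum_of_eq_card_smul_eSub [Fintype G] (S : Subgroup G) [DecidablePred (· ∈ S)] :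
    ∑ g : S, MonoidAlgebra.of K G (g : G) = (Nat.card S : K) • eSub K S := by
  rw [eSub_eq_sum, smul_inv_smul₀ (Nat.cast_ne_zero.2 Nat.card_pos.ne')]

lemma eSub_mul_eSub_of_le {S T : Subgroup G} (h : S ≤ T) :
    eSub K S * eSub K T = eSub K T := by
  classical
  have := Fintype.ofFinite G
  rw [eSub_eq_sum S, smul_mul_assoc, Finset.sum_mul,
    Finset.sum_congr rfl fun x _ => of_mul_eSub (h x.2), Finset.sum_const, Finset.card_univ,
    ← Nat.card_eq_fintype_card, ← Nat.cast_smul_eq_nsmul K,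
    inv_smul_smul₀ (Nat.cast_ne_zero.2 Nat.card_pos.ne')]

lemma eSub_mul_eSub_of_ge {S T : Subgroup G} (h : S ≤ T) :
    eSub K T * eSub K S = eSub K T := by
  classical
  have := Fintype.ofFinite G
  rw [eSub_eq_sum S, mul_smul_comm, Finset.mul_sum,
    Finset.sum_congr rfl fun x _ => eSub_mul_of (h x.2), Finset.sum_const, Finset.card_univ,
    ← Nat.card_eq_fintype_card, ← Nat.cast_smul_eq_nsmul K,
    inv_smul_smul₀ (Nat.cast_ne_zero.2 Nat.card_pos.ne')]

lemma eSub_ne_zero (S : Subgroup G) : eSub K S ≠ 0 := by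
  classical
  have := Fintype.ofFinite G
  intro h
  have h1 := congrArg (MonoidAlgebra.lift K K G 1) h
  rw [eSub_eq_sum, map_smul, map_sum, map_zero,
    Finset.sum_congr rfl fun x _ => MonoidAlgebra.lift_of _ _] at h1
  simp at h1

lemma eSub_ne_eSub_top {S : Subgroup G} {g : G} (hg : g ∉ S) : eSub K S ≠ eSub K ⊤ := by
  classical
  have := Fintype.ofFinite G
  intro h
  have h1 := congrArg (fun x : MonoidAlgebra K G => x.coeff g) h
  have h2 : ∀ x : S, (MonoidAlgebra.of K G (x : G)).coeff g = 0 := fun x => by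
    rw [MonoidAlgebra.of_apply, MonoidAlgebra.coeff_single, Finsupp.single_apply,
      if_neg fun hx : (x : G) = g => hg (hx ▸ x.2)]
  have h3 : ∀ x : (⊤ : Subgroup G), (MonoidAlgebra.of K G (x : G)).coeff g
      = if x = ⟨g, Subgroup.mem_top g⟩ then 1 else 0 := fun x => by
    rw [MonoidAlgebra.of_apply, MonoidAlgebra.coeff_single, Finsupp.single_apply]
    simp only [Subtype.ext_iff]
  simp only [eSub_eq_sum, MonoidAlgebra.coeff_smul, MonoidAlgebra.coeff_sum, Finsupp.smul_apply,
    Finsupp.finsetSum_apply, h2, h3, Finset.sum_const_zero, Finset.sum_ite_eq', Finset.mem_univ,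
    if_true, smul_eq_mul, mul_one, mul_zero] at h1
  exact inv_ne_zero (Nat.cast_ne_zero.2 Nat.card_pos.ne') h1.symm

/-- If the complement of `B` is the disjoint union of `N` cosets `v⁻¹ s B` with `v ∈ B`, then
`e_B s e_B` is a combination of `e_G` and `e_B`. -/
lemma eSub_mul_of_mul_eSub {B : Subgroup G} {s : G} (hs : s * s = 1) (hsB : s ∉ B)
    {P : Type*} [Finite P] (v : P → G) (hv : ∀ x, v x ∈ B)
    (hcell : ∀ g ∉ B, ∃! x, s * v x * g ∈ B) {N : ℕ} (hN : Nat.card P = N) :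
    (N : K) • (eSub K B * MonoidAlgebra.of K G s * eSub K B)
      = ((N : K) + 1) • eSub K ⊤ - eSub K B := by
  classical
  have := Fintype.ofFinite G
  have := Fintype.ofFinite P
  have hsi : s⁻¹ = s := inv_eq_of_mul_eq_one_left hs
  have hmem : ∀ (x : P) (b : B), (v x)⁻¹ * s * b ∉ B := fun x b h =>
    hsB (by simpa [mul_assoc] using B.mul_mem (B.mul_mem (hv x) h) (B.inv_mem b.2))
  let f : P × B → {g : G // g ∉ B} := fun y => ⟨(v y.1)⁻¹ * s * y.2, hmem _ _⟩
  have hf : Function.Bijective f := by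
    constructor
    · rintro ⟨x, b⟩ ⟨y, c⟩ h
      have h' : (v x)⁻¹ * s * b = (v y)⁻¹ * s * c := congrArg Subtype.val h
      have hx : s * v x * ((v x)⁻¹ * s * b) ∈ B := by
        simp [mul_assoc, mul_inv_cancel_left, ← mul_assoc s s, hs]
      have hy : s * v y * ((v x)⁻¹ * s * b) ∈ B := by
        rw [h']; simp [mul_assoc, mul_inv_cancel_left, ← mul_assoc s s, hs]
      obtain rfl := (hcell _ (hmem x b)).unique hx hy
      have : (b : G) = c := mul_left_cancel h'
      exact Prod.ext rfl (Subtype.ext this)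
    · rintro ⟨g, hg⟩
      obtain ⟨x, hx, -⟩ := hcell g hg
      exact ⟨(x, ⟨_, hx⟩), Subtype.ext (by simp [f, mul_assoc, ← mul_assoc s s, hs])⟩
  have hB : (Nat.card B : K) ≠ 0 := Nat.cast_ne_zero.2 Nat.card_pos.ne'
  have hcard : (Nat.card G : K) = Nat.card B * (N + 1) := by
    have h1 := Fintype.card_subtype_compl (fun g : G => g ∈ B)
    have h2 := Fintype.card_of_bijective hf
    have h3 := Fintype.card_subtype_le (fun g : G => g ∈ B)
    rw [Fintype.card_prod] at h2
    simp only [Nat.card_eq_fintype_card] at hN ⊢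
    have : Fintype.card G = Fintype.card B * (N + 1) := by
      rw [← hN, mul_add, mul_one, mul_comm]
      change Fintype.card B ≤ _ at h3
      change _ = _ - Fintype.card B at h1
      omega
    exact_mod_cast this
  have htop : ∑ g : G, MonoidAlgebra.of K G g = (Nat.card G : K) • eSub K ⊤ := by
    rw [← Subgroup.card_top (G := G), ← sum_of_eq_card_smul_eSub]
    exact Fintype.sum_equiv Subgroup.topEquiv.symm.toEquiv _ _ fun _ => rfl
  have hsplit : ∑ g : G, MonoidAlgebra.of K G g = ∑ b : B, MonoidAlgebra.of K G (b : G)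
      + ∑ y : P × B, MonoidAlgebra.of K G ((v y.1)⁻¹ * s * y.2) := by
    rw [← Fintype.sum_subtype_add_sum_subtype (fun g : G => g ∈ B)]
    congr 1
    exact (Fintype.sum_bijective f hf _ _ fun _ => rfl).symm
  have hcellsum : eSub K B * ∑ y : P × B, MonoidAlgebra.of K G ((v y.1)⁻¹ * s * y.2)
      = ((N : K) * Nat.card B) • (eSub K B * MonoidAlgebra.of K G s * eSub K B) := by
    rw [Fintype.sum_prod_type, Finset.mul_sum]
    have : ∀ x : P, eSub K B * ∑ b : B, MonoidAlgebra.of K G ((v x)⁻¹ * s * b)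
        = (Nat.card B : K) • (eSub K B * MonoidAlgebra.of K G s * eSub K B) := fun x => by
      simp_rw [map_mul]
      rw [← Finset.mul_sum, sum_of_eq_card_smul_eSub, ← mul_assoc, ← mul_assoc,
        eSub_mul_of (B.inv_mem (hv x)), mul_smul_comm]
    rw [Finset.sum_congr rfl fun x _ => this x, Finset.sum_const, Finset.card_univ,
      ← Nat.card_eq_fintype_card, hN, ← Nat.cast_smul_eq_nsmul K, smul_smul]
  have key := congrArg (eSub K B * ·) hsplit
  simp only [mul_add, hcellsum, htop, sum_of_eq_card_smul_eSub, mul_smul_comm,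
    eSub_mul_eSub_of_le le_top, eSub_mul_eSub_of_le le_rfl] at key
  rw [hcard, mul_comm (N : K), mul_smul, mul_smul, ← smul_add] at key
  rw [smul_right_injective _ hB key]
  abel

/-- Right multiplication by `c e_B s e_B` on `K[G] e_B` has the eigenvalues `c` and `-c / N`, and
no others. -/
lemma hecke_quadratic {B : Subgroup G} {s : G} (hs : s * s = 1) (hsB : s ∉ B)
    {P : Type*} [Finite P] (v : P → G) (hv : ∀ x, v x ∈ B)
    (hcell : ∀ g ∉ B, ∃! x, s * v x * g ∈ B) {N : ℕ} (hN : Nat.card P = N) (hN0 : N ≠ 0)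
    (c : K) {X : MonoidAlgebra K G}
    (hX : X = c • (eSub K B * MonoidAlgebra.of K G s * eSub K B)) :
    (∀ a : MonoidAlgebra K G, a * eSub K B * X * X + (c / N - c) • (a * eSub K B * X)
      = (c ^ 2 / N) • (a * eSub K B)) ∧
    (∃ v : MonoidAlgebra K G, (∃ a, v = a * eSub K B) ∧ v ≠ 0 ∧ v * X = c • v) ∧
    (∃ v : MonoidAlgebra K G, (∃ a, v = a * eSub K B) ∧ v ≠ 0 ∧ v * X = (-(c / N)) • v) := by
  have hN' : (N : K) ≠ 0 := Nat.cast_ne_zero.2 hN0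
  have h1 : eSub K B * eSub K ⊤ = eSub K ⊤ := eSub_mul_eSub_of_le (K := K) le_top
  have h2 : eSub K ⊤ * eSub K B = eSub K ⊤ := eSub_mul_eSub_of_ge (K := K) le_top
  have h3 : eSub K B * eSub K B = eSub K B := eSub_mul_eSub_of_le (K := K) le_rfl
  have h4 : eSub K (⊤ : Subgroup G) * eSub K ⊤ = eSub K ⊤ := eSub_mul_eSub_of_le (K := K) le_rfl
  have hX' : X = (c + c / N) • eSub K ⊤ - (c / N) • eSub K B := by
    rw [hX, ← inv_smul_smul₀ hN' (eSub K B * _ * _), eSub_mul_of_mul_eSub hs hsB v hv hcell hN,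
      smul_sub, smul_sub, smul_smul, smul_smul, smul_smul]
    congr 2 <;> field_simp
  have hne : eSub K B ≠ eSub K ⊤ := eSub_ne_eSub_top hsB
  have hε : eSub K (⊤ : Subgroup G) ≠ 0 := eSub_ne_zero ⊤
  subst hX'
  generalize eSub K B = e at *
  generalize eSub K (⊤ : Subgroup G) = ε at *
  refine ⟨fun a => ?_, ⟨ε, ⟨ε, h2.symm⟩, ?_, ?_⟩, ⟨e - ε, ⟨e - ε, ?_⟩, sub_ne_zero.2 hne, ?_⟩⟩
  · simp only [mul_sub, sub_mul, mul_smul_comm, smul_mul_assoc, mul_assoc, h1, h2, h3, h4]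
    module
  · exact hε
  · simp only [mul_sub, mul_smul_comm, h2, h4]
    module
  · rw [sub_mul, h2, h3]
  · simp only [mul_sub, sub_mul, mul_smul_comm, h1, h2, h3, h4]
    module

end GroupAlgebra

section Unitary

variable {F : Type*} [Field F] {φ : F →+* F} {n : ℕ}

lemma Junit_inv : (Junit F n)⁻¹ = Junit F n := Units.ext rfl

lemma mem_GU_iff {g : GL (Fin n) F} :
    g ∈ GU F φ n ↔ (g.val.map φ)ᵀ * (Jmat F n * g.val) = Jmat F n := by
  have h1 : g ∈ GU F φ n ↔
      Junit F n * transposeInvHom F n (Matrix.GeneralLinearGroup.map φ g) * (Junit F n)⁻¹ = g :=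
    Iff.rfl
  have h2 : ((transposeInvHom F n (Matrix.GeneralLinearGroup.map φ g))⁻¹).val = (g.val.map φ)ᵀ :=
    rfl
  rw [h1, Junit_inv, mul_assoc, ← eq_inv_mul_iff_mul_eq, Junit_inv, ← eq_inv_mul_iff_mul_eq,
    eq_comm, Units.ext_iff, Units.val_mul, Units.val_mul, h2]
  rfl

/-- A matrix preserving the hermitian form, as an element of the unitary group. -/
def GU.mk (M : Matrix (Fin n) (Fin n) F) (hM : (M.map φ)ᵀ * (Jmat F n * M) = Jmat F n) :
    GU F φ n :=
  have h : (Jmat F n * (M.map φ)ᵀ * Jmat F n) * M = 1 := by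
    rw [mul_assoc, mul_assoc, hM, Jmat_mul_self]
  ⟨⟨M, _, mul_eq_one_comm.1 h, h⟩, mem_GU_iff.2 hM⟩

lemma GU_col_form (g : GU F φ n) (i j : Fin n) :
    ∑ k, φ (g.1.val k i) * g.1.val k.rev j = if j = i.rev then 1 else 0 := by
  have h := congrFun₂ (mem_GU_iff.1 g.2) i j
  simpa [Matrix.mul_apply, Jmat] using h

lemma mem_borelGU_two {g : GU F φ 2} : g ∈ borelGU F φ 2 ↔ g.1.val 1 0 = 0 := by
  refine ⟨fun h => h (by decide), fun h i j hij => ?_⟩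
  fin_cases i <;> fin_cases j <;> simp_all

lemma mem_borelGU_three {g : GU F φ 3} : g ∈ borelGU F φ 3 ↔ g.1.val 2 0 = 0 := by
  refine ⟨fun h => h (by decide), fun h i j hij => ?_⟩
  have h00 := GU_col_form g 0 0
  have h01 := GU_col_form g 0 1
  have h02 := GU_col_form g 0 2
  simp [Fin.sum_univ_three, h, Fin.rev_eq] at h00 h01 h02
  simp [h00] at h01 h02
  have : g.1.val 0 0 ≠ 0 := fun h' => by simp [h'] at h02
  fin_cases i <;> fin_cases j <;> simp_all

lemma existsUnique_cell_two {s : GU F φ 2} (hs : s.1.val = permMat F 2 (Equiv.swap 0 1))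
    (v : {z : F // z + φ z = 0} → GU F φ 2) (hv : ∀ x, (v x).1.val = !![1, x.1; 0, 1])
    {g : GU F φ 2} (hg : g ∉ borelGU F φ 2) :
    ∃! x, s * v x * g ∈ borelGU F φ 2 := by
  rw [mem_borelGU_two] at hg
  have h00 := GU_col_form g 0 0
  simp [Fin.sum_univ_two, Fin.rev_eq] at h00
  have key : ∀ x, s * v x * g ∈ borelGU F φ 2 ↔ g.1.val 0 0 + x.1 * g.1.val 1 0 = 0 := by
    intro x
    rw [mem_borelGU_two]
    simp [hs, hv, permMat, Matrix.mul_apply, Fin.sum_univ_two]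
  simp only [key]
  refine ⟨⟨-(g.1.val 0 0 / g.1.val 1 0), ?_⟩, ?_, ?_⟩
  · have : φ (g.1.val 1 0) ≠ 0 := by simpa using hg
    simp only [map_neg, map_div₀]
    field_simp
    linear_combination -h00
  · dsimp only
    field_simp
    ring
  · rintro ⟨z, hz⟩ h
    refine Subtype.ext ?_
    dsimp only at h ⊢
    field_simp
    linear_combination h

lemma existsUnique_cell_three (hφ : Function.Involutive φ) {s : GU F φ 3}
    (hs : s.1.val = permMat F 3 (Equiv.swap 0 2))
    (v : {x : F × F // x.2 + φ x.2 + x.1 * φ x.1 = 0} → GU F φ 3)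
    (hv : ∀ x, (v x).1.val = !![1, x.1.1, x.1.2; 0, 1, -φ x.1.1; 0, 0, 1])
    {g : GU F φ 3} (hg : g ∉ borelGU F φ 3) :
    ∃! x, s * v x * g ∈ borelGU F φ 3 := by
  rw [mem_borelGU_three] at hg
  have h00 := GU_col_form g 0 0
  simp [Fin.sum_univ_three, Fin.rev_eq] at h00
  have key : ∀ x, s * v x * g ∈ borelGU F φ 3 ↔
      g.1.val 0 0 + x.1.1 * g.1.val 1 0 + x.1.2 * g.1.val 2 0 = 0 := by
    intro x
    rw [mem_borelGU_three]
    simp [hs, hv, permMat, Matrix.mul_apply, Fin.sum_univ_three, Equiv.swap_apply_def]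
  simp only [key]
  generalize g.1.val 0 0 = a at *
  generalize g.1.val 1 0 = b at *
  generalize g.1.val 2 0 = c at *
  have hc : φ c ≠ 0 := by simpa using hg
  refine ⟨⟨(φ b / φ c, -(a + φ b / φ c * b) / c), ?_⟩, ?_, ?_⟩
  · simp only [map_neg, map_div₀, map_add, map_mul, hφ _]
    field_simp
    linear_combination -h00
  · dsimp only
    field_simp
    ring
  · rintro ⟨⟨y, z⟩, hz⟩ h
    dsimp only at h hz
    have hz' : z = -(a + y * b) / c := by
      field_simp
      linear_combination h
    have hy : y = φ b / φ c := by
      have : (y * φ c - φ b) * φ (y * φ c - φ b) = 0 := by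
        rw [hz'] at hz
        simp only [map_neg, map_div₀, map_add, map_mul, map_sub, hφ _] at hz ⊢
        field_simp at hz
        linear_combination hz + h00
      rw [eq_div_iff hc, ← sub_eq_zero]
      simpa only [mul_eq_zero, map_eq_zero, or_self] using this
    subst hy
    simp [hz']

end Unitary

section Counting

variable {F : Type*} [Field F] [Fintype F] {q : ℕ} {φ : F →+* F}

lemma frobenius_involutive (hcard : Fintype.card F = q ^ 2) (hφ : ∀ x : F, φ x = x ^ q) :
    Function.Involutive φ := fun x => by
  rw [hφ, hφ, ← pow_mul, ← sq, ← hcard, FiniteField.pow_card]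

lemma card_trace_fiber (hq : 1 < q) (hcard : Fintype.card F = q ^ 2) (hφ : ∀ x : F, φ x = x ^ q)
    {t : F} (ht : φ t = t) : Nat.card {z : F // z + φ z = t} = q := by
  classical
  let T : F →+ F := AddMonoidHom.id F + φ.toAddMonoidHom
  have hT : ∀ z, T z = z + φ z := fun z => rfl
  have hroots : ∀ c : F, Nat.card {z : F // z ^ q + c * z = 0} ≤ q := fun c => by
    let P : Polynomial F := .X ^ q + .C c * .X
    have hdeg : (Polynomial.C c * Polynomial.X).natDegree < q :=
      (Polynomial.natDegree_C_mul_le _ _).trans_lt (by simpa using hq)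
    have hP : P.natDegree = q := by
      rw [Polynomial.natDegree_add_eq_left_of_natDegree_lt] <;> simp [hdeg]
    have hP0 : P ≠ 0 := Polynomial.ne_zero_of_natDegree_gt (hP ▸ hq)
    rw [Nat.card_eq_fintype_card, Fintype.card_subtype]
    refine le_trans (Finset.card_le_card fun z hz => ?_) ((Multiset.toFinset_card_le _).trans
      ((Polynomial.card_roots' P).trans hP.le))
    simpa [P, hP0] using hz
  have hker : Nat.card T.ker ≤ q := by
    refine le_trans (le_of_eq (Nat.card_congr (Equiv.subtypeEquivRight fun z => ?_))) (hroots 1)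
    rw [AddMonoidHom.mem_ker, hT, hφ, one_mul, add_comm]
  let R : AddSubgroup F := (φ.toAddMonoidHom - AddMonoidHom.id F).ker
  have hR : ∀ z, z ∈ R ↔ φ z = z := fun z => by
    rw [AddMonoidHom.mem_ker, AddMonoidHom.sub_apply, sub_eq_zero]; rfl
  have hRcard : Nat.card R ≤ q := by
    refine le_trans (le_of_eq (Nat.card_congr (Equiv.subtypeEquivRight fun z => ?_))) (hroots (-1))
    rw [hR, hφ, neg_one_mul, ← sub_eq_add_neg, sub_eq_zero]
  have hle : T.range ≤ R := by
    rintro _ ⟨z, rfl⟩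
    rw [hR, hT, map_add, frobenius_involutive hcard hφ, add_comm]
  have hprod : Nat.card T.ker * Nat.card T.range = q ^ 2 := by
    rw [← hcard, ← Nat.card_eq_fintype_card, ← AddSubgroup.index_ker]
    exact T.ker.card_mul_index
  have hrange : Nat.card T.range ≤ Nat.card R := AddSubgroup.card_le_of_le hle
  have hkq : Nat.card T.ker = q := by nlinarith
  have hrq : Nat.card T.range = q := by nlinarith
  have heq : T.range = R := AddSubgroup.eq_of_le_of_card_ge hle (by omega)
  obtain ⟨w, hw⟩ : t ∈ T.range := heq ▸ (hR t).2 ht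
  rw [← hkq]
  refine Nat.card_congr ((Equiv.subRight w).subtypeEquiv fun z => ?_)
  rw [Equiv.subRight_apply, AddMonoidHom.mem_ker, map_sub, sub_eq_zero, hw, hT]

lemma card_hermitian_pairs (hq : 1 < q) (hcard : Fintype.card F = q ^ 2)
    (hφ : ∀ x : F, φ x = x ^ q) :
    Nat.card {x : F × F // x.2 + φ x.2 + x.1 * φ x.1 = 0} = q ^ 3 := by
  classical
  have e : {x : F × F // x.2 + φ x.2 + x.1 * φ x.1 = 0} ≃
      Σ y : F, {z : F // z + φ z = -(y * φ y)} :=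
    { toFun x := ⟨x.1.1, x.1.2, eq_neg_of_add_eq_zero_left x.2⟩
      invFun x := ⟨(x.1, x.2.1), by rw [x.2.2, neg_add_cancel]⟩ }
  have h : ∀ y : F, φ (-(y * φ y)) = -(y * φ y) := fun y => by
    rw [map_neg, map_mul, frobenius_involutive hcard hφ, mul_comm]
  rw [Nat.card_congr e, Nat.card_sigma,
    Finset.sum_congr rfl fun y _ => card_trace_fiber hq hcard hφ (h y), Finset.sum_const, Finset.card_univ, hcard, smul_eq_mul]
  ring

end Counting

theorem statement7
    {F : Type*} [Field F] [Fintype F] [DecidableEq F]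
    {K : Type*} [Field K] [CharZero K]
    (p k q : ℕ) (hp : Nat.Prime p) (hk : 0 < k) (hq : q = p ^ k)
    (hcard : Fintype.card F = q ^ 2)
    (φ : F →+* F) (hφ : ∀ x : F, φ x = x ^ q)
    (σ : GU F φ 2)
    (hσ : ((σ : GL (Fin 2) F) : Matrix (Fin 2) (Fin 2) F)
        = permMat F 2 (Equiv.swap 0 1))
    (τ : GU F φ 3)
    (hτ : ((τ : GL (Fin 3) F) : Matrix (Fin 3) (Fin 3) F)
        = permMat F 3 (Equiv.swap 0 2)) :
    -- (1): `U₀` is the subgroup of upper triangular matrices of `G₂`,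
    -- `e = e_{U₀}`, `X = e·σ·e`, `ρ` is right multiplication by `X` on `K[G₂]·e`
    (let e : MonoidAlgebra K ↥(GU F φ 2) := eSub K (borelGU F φ 2)
     let X : MonoidAlgebra K ↥(GU F φ 2) :=
       e * MonoidAlgebra.of K ↥(GU F φ 2) σ * e
     -- `(ρ - 1)(ρ + q⁻¹) = 0` on `K[G₂]·e`
     (∀ a : MonoidAlgebra K ↥(GU F φ 2),
        a * e * X * X + ((q : K)⁻¹ - 1) • (a * e * X) = (q : K)⁻¹ • (a * e)) ∧
     -- both `1` and `-q⁻¹` occur as eigenvalues of `ρ`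
     (∃ v : MonoidAlgebra K ↥(GU F φ 2),
        (∃ a, v = a * e) ∧ v ≠ 0 ∧ v * X = v) ∧
     (∃ v : MonoidAlgebra K ↥(GU F φ 2),
        (∃ a, v = a * e) ∧ v ≠ 0 ∧ v * X = -(q : K)⁻¹ • v)) ∧
    -- (2): `B₃` is the subgroup of upper triangular matrices of `G₃`,
    -- `e' = e_{B₃}`, `X' = (-q)·e'·τ·e'`
    (let e' : MonoidAlgebra K ↥(GU F φ 3) := eSub K (borelGU F φ 3)
     let X' : MonoidAlgebra K ↥(GU F φ 3) :=
       (-(q : K)) • (e' * MonoidAlgebra.of K ↥(GU F φ 3) τ * e')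
     -- `(ρ' + q)(ρ' - q⁻²) = 0` on `K[G₃]·e'`
     (∀ a : MonoidAlgebra K ↥(GU F φ 3),
        a * e' * X' * X' + ((q : K) - ((q : K) ^ 2)⁻¹) • (a * e' * X')
          = (q : K)⁻¹ • (a * e')) ∧
     -- both `-q` and `q⁻²` occur as eigenvalues of `ρ'`
     (∃ v : MonoidAlgebra K ↥(GU F φ 3),
        (∃ a, v = a * e') ∧ v ≠ 0 ∧ v * X' = -(q : K) • v) ∧
     (∃ v : MonoidAlgebra K ↥(GU F φ 3),
        (∃ a, v = a * e') ∧ v ≠ 0 ∧ v * X' = ((q : K) ^ 2)⁻¹ • v)) := by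
  have hq1 : 1 < q := hq ▸ Nat.one_lt_pow hk.ne' hp.one_lt
  have hq0 : (q : K) ≠ 0 := Nat.cast_ne_zero.2 (by omega)
  have hinv := frobenius_involutive hcard hφ
  have hss : σ * σ = 1 := by
    refine Subtype.ext (Units.ext ?_)
    ext i j
    fin_cases i <;> fin_cases j <;>
      simp [hσ, permMat, Matrix.mul_apply, Fin.sum_univ_two]
  have htt : τ * τ = 1 := by
    refine Subtype.ext (Units.ext ?_)
    ext i j
    fin_cases i <;> fin_cases j <;>
      simp [hτ, permMat, Matrix.mul_apply, Fin.sum_univ_three, Equiv.swap_apply_def]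
  have hsB : σ ∉ borelGU F φ 2 := by simp [mem_borelGU_two, hσ, permMat]
  have htB : τ ∉ borelGU F φ 3 := by simp [mem_borelGU_three, hτ, permMat]
  let v : {z : F // z + φ z = 0} → GU F φ 2 := fun x => GU.mk !![1, x.1; 0, 1] (by
    ext i j
    fin_cases i <;> fin_cases j <;>
      simp [Matrix.mul_apply, Fin.sum_univ_two, Jmat, Fin.rev_eq]
    linear_combination x.2)
  let w : {x : F × F // x.2 + φ x.2 + x.1 * φ x.1 = 0} → GU F φ 3 := fun x =>
    GU.mk !![1, x.1.1, x.1.2; 0, 1, -φ x.1.1; 0, 0, 1] (by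
      ext i j
      fin_cases i <;> fin_cases j <;>
        simp [Matrix.mul_apply, Fin.sum_univ_three, Jmat, Fin.rev_eq, hinv _]
      linear_combination x.2)
  constructor
  · have H := hecke_quadratic hss hsB v (fun x => mem_borelGU_two.2 (by simp [v, GU.mk]))
      (fun g hg => existsUnique_cell_two hσ v (fun _ => rfl) hg)
      (card_trace_fiber hq1 hcard hφ (map_zero φ)) (by omega) (1 : K) (one_smul K _).symm
    simpa only [one_pow, one_div, one_smul] using H
  · have H := hecke_quadratic htt htB w (fun x => mem_borelGU_three.2 (by simp [w, GU.mk]))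
      (fun g hg => existsUnique_cell_three hinv hτ w (fun _ => rfl) hg)
      (card_hermitian_pairs hq1 hcard hφ) (pow_ne_zero 3 (by omega)) (-(q : K)) rfl
    have h1 : -(q : K) / ((q ^ 3 : ℕ) : K) = -((q : K) ^ 2)⁻¹ := by
      push_cast
      field_simp
    have h2 : (-(q : K)) ^ 2 / ((q ^ 3 : ℕ) : K) = (q : K)⁻¹ := by
      push_cast
      field_simp
    rw [h1, h2, neg_neg, neg_sub_neg] at H
    exact H
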